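/- For a 2-class M/G/1 queue with 0 < ρ₁, 0 < ρ₂, ρ = ρ₁+ρ₂ < 1, W₀ > 0, for each α ∈ [0,1] the relative priority parameter p₁ = αρ₂(2-ρ₁-ρ₂)(1-ρ₂)(1-ρ₁-ρ₂) / ((αρ₂(ρ₁+ρ₂-2)+1-ρ₁)(ρ₂(1-ρ₂)-ρ₁(1-ρ₁)) + ρ(1-ρ₁)(1-ρ₂)(1-ρ₁-ρ₂)) satisfies W₁^RP(p₁) = αW₁¹² + (1-α)W₁²¹, with α = 0 ↦ p₁ = 0 and α = 1 ↦ p₁ = 1. -/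

import Mathlib

theorem convex_weight_pos {a b t : ℝ} (ha : 0 < a) (hb : 0 < b) (h0 : 0 ≤ t) (h1 : t ≤ 1) :
    0 < (1 - t) * a + t * b :=
  (convex_Ioi (0 : ℝ)) ha hb (sub_nonneg.2 h1) h0 (by ring)


theorem relative_priority_achieves_convex_combination
    (ρ₁ ρ₂ W₀ : ℝ) (h₁ : 0 < ρ₁) (h₂ : 0 < ρ₂) (hρ : ρ₁ + ρ₂ < 1) (hW : 0 < W₀) :
    let ρ := ρ₁ + ρ₂
    let W₁RP : ℝ → ℝ := fun p₁ =>
      (1 - ρ * p₁) * W₀ /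
        ((1 - ρ₁ - (1 - p₁) * ρ₂) * (1 - ρ₂ - p₁ * ρ₁) - p₁ * (1 - p₁) * ρ₁ * ρ₂)
    let P : ℝ → ℝ := fun α =>
      α * ρ₂ * (2 - ρ₁ - ρ₂) * (1 - ρ₂) * (1 - ρ₁ - ρ₂) /
        ((α * ρ₂ * (ρ₁ + ρ₂ - 2) + 1 - ρ₁) * (ρ₂ * (1 - ρ₂) - ρ₁ * (1 - ρ₁))
          + ρ * (1 - ρ₁) * (1 - ρ₂) * (1 - ρ₁ - ρ₂))
    (∀ α ∈ Set.Icc (0 : ℝ) 1,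
      W₁RP (P α) = α * (W₀ / (1 - ρ₁)) + (1 - α) * (W₀ / ((1 - ρ₂) * (1 - ρ₁ - ρ₂)))) ∧
    P 0 = 0 ∧ P 1 = 1 := by
  intro ρ W₁RP P
  have ha : 0 < 1 - ρ₁ := by linarith
  have hb : 0 < 1 - ρ₂ := by linarith
  have hs : 0 < 1 - ρ₁ - ρ₂ := by linarith
  have ht : 0 < 2 - ρ₁ - ρ₂ := by linarith
  have hP : ∀ α ∈ Set.Icc (0 : ℝ) 1,
      P α = α * (1 - ρ₂) / ((1 - α) * (1 - ρ₁) + α * (1 - ρ₂)) := by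
    rintro α ⟨h0, h1⟩
    have hE := convex_weight_pos ha hb h0 h1
    have hD : (α * ρ₂ * (ρ₁ + ρ₂ - 2) + 1 - ρ₁) * (ρ₂ * (1 - ρ₂) - ρ₁ * (1 - ρ₁))
          + (ρ₁ + ρ₂) * (1 - ρ₁) * (1 - ρ₂) * (1 - ρ₁ - ρ₂)
        = ρ₂ * (2 - ρ₁ - ρ₂) * (1 - ρ₁ - ρ₂) * ((1 - α) * (1 - ρ₁) + α * (1 - ρ₂)) := by
      ring
    simp only [P, ρ]
    rw [hD, div_eq_div_iff (by positivity) hE.ne']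
    ring
  refine ⟨fun α hα => ?_, by simp [P], ?_⟩
  · rw [hP α hα]
    have hE := convex_weight_pos ha hb hα.1 hα.2
    set E := (1 - α) * (1 - ρ₁) + α * (1 - ρ₂) with hE_def
    have hden : (1 - ρ₁ - (1 - α * (1 - ρ₂) / E) * ρ₂) * (1 - ρ₂ - α * (1 - ρ₂) / E * ρ₁)
          - α * (1 - ρ₂) / E * (1 - α * (1 - ρ₂) / E) * ρ₁ * ρ₂
        = (1 - ρ₁ - ρ₂) * (1 - ρ₁) * (1 - ρ₂) / E := by
      field_simp
      rw [hE_def]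
      ring
    have hnum : 1 - (ρ₁ + ρ₂) * (α * (1 - ρ₂) / E)
        = ((1 - α) * (1 - ρ₁) + α * (1 - ρ₂) * (1 - ρ₁ - ρ₂)) / E := by
      field_simp
      rw [hE_def]
      ring
    simp only [W₁RP, ρ]
    rw [hden, hnum]
    field_simp
    ring
  · rw [hP 1 (by simp)]
    simp [hb.ne']
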